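/- Let k** ∈ ℕ, let G be a finite graph with the non-k**-tree property, and let ε be a real with 0 < ε < 1/2^{k**}. Then for every A ⊆ G with |A| ≥ 1/ε^{k**} there exists A′ ⊆ A with |A′| ≥ ε^{k**−1}·|A| such that A′ is ε-excellent. -/

import Mathlib

open Finset

open scoped Classical

namespace Paper

variable {V : Type}

/-- `G` has the `k`-order property. -/
def HasOrderProp (G : SimpleGraph V) (k : ℕ) : Prop :=
  ∃ a b : Fin k → V, ∀ i j : Fin k, i < j → G.Adj (a i) (b j) ∧ ¬ G.Adj (a j) (b i)

/-- `G` has the non-`k`-order property. -/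
def NoOrderProp (G : SimpleGraph V) (k : ℕ) : Prop := ¬ HasOrderProp G k

/-- `G` has the non-`k`-tree property. -/
def NoTreeProp (G : SimpleGraph V) (k : ℕ) : Prop :=
  ¬ ∃ (a : (Fin k → Bool) → V) (b : (m : Fin k) → (Fin (m : ℕ) → Bool) → V),
      ∀ (η : Fin k → Bool) (m : Fin k) (ρ : Fin (m : ℕ) → Bool),
        (∀ i : Fin (m : ℕ), η ⟨i.1, i.2.trans m.2⟩ = ρ i) →
        (G.Adj (a η) (b m ρ) ↔ η m = true)

/-- The truth value `t` is the `ζ`-average of the vertex `a` over the set `B`: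
all but fewer than `ζ|B|` of the `b ∈ B` satisfy `(a R b) ≡ t`. -/
def AvgIs (G : SimpleGraph V) (ζ : ℝ) (B : Finset V) (a : V) (t : Bool) : Prop :=
  ((B.filter fun b => ¬ (G.Adj a b ↔ t = true)).card : ℝ) < ζ * B.card

/-- `A` is `ε`-good. -/
def Good (G : SimpleGraph V) (ε : ℝ) (A : Finset V) : Prop :=
  ∀ b : V, ∃ t : Bool, AvgIs G ε A b t

/-- `A` is `(ε,ζ)`-excellent. -/
def Excellent (G : SimpleGraph V) (ε ζ : ℝ) (A : Finset V) : Prop :=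
  Good G ε A ∧
    ∀ B : Finset V, Good G ζ B →
      ∃ t : Bool, ((A.filter fun a => ¬ AvgIs G ζ B a t).card : ℝ) < ε * A.card

/-- The pair `(A,B)` is `(ε,ζ)`-uniform. -/
def Uniform (G : SimpleGraph V) (ε ζ : ℝ) (A B : Finset V) : Prop :=
  ∃ t : Bool, ((A.filter fun a => ¬ AvgIs G ζ B a t).card : ℝ) < ε * A.card

/-- `A` is `f`-indivisible. -/
def Indivisible (G : SimpleGraph V) (f : ℕ → ℕ) (A : Finset V) : Prop :=
  ∀ b : V, ∃ t : Bool, (A.filter fun a => ¬ (G.Adj a b ↔ t = true)).card < f A.card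

/-- `A` is `ε`-indivisible, for a real `ε ∈ (0,1)`. -/
def EpsIndivisible (G : SimpleGraph V) (ε : ℝ) (A : Finset V) : Prop :=
  ∀ b : V, ∃ t : Bool,
    ((A.filter fun a => ¬ (G.Adj a b ↔ t = true)).card : ℝ) < (A.card : ℝ) ^ ε

/-- The edge density between `A` and `B`. -/
noncomputable def density (G : SimpleGraph V) (A B : Finset V) : ℝ :=
  (((A ×ˢ B).filter fun p => G.Adj p.1 p.2).card : ℝ) / (A.card * B.card)

/-- The pair `(A,B)` is `ε`-regular. -/
def Regular (G : SimpleGraph V) (ε : ℝ) (A B : Finset V) : Prop :=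
  ∀ A' ⊆ A, ∀ B' ⊆ B, ε * A.card ≤ (A'.card : ℝ) → ε * B.card ≤ (B'.card : ℝ) →
    |density G A B - density G A' B'| < ε

/-- The sequence `⟨a_i : i < n⟩` is `Δ_k`-indiscernible. -/
def DeltaIndiscernible (G : SimpleGraph V) (k : ℕ) {n : ℕ} (a : Fin n → V) : Prop :=
  Function.Injective a ∧
  (∀ i₀ i₁ j₀ j₁ : Fin n, i₀ < i₁ → j₀ < j₁ →
    (G.Adj (a i₀) (a i₁) ↔ G.Adj (a j₀) (a j₁))) ∧
  (∀ m : ℕ, m ≤ k → ∀ i j : Fin k → Fin n, StrictMono i → StrictMono j →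
    (((∃ y : V, (∀ ℓ : Fin k, (ℓ : ℕ) < m → G.Adj y (a (i ℓ))) ∧
                (∀ ℓ : Fin k, m ≤ (ℓ : ℕ) → ¬ G.Adj y (a (i ℓ)))) ↔
      (∃ y : V, (∀ ℓ : Fin k, (ℓ : ℕ) < m → G.Adj y (a (j ℓ))) ∧
                (∀ ℓ : Fin k, m ≤ (ℓ : ℕ) → ¬ G.Adj y (a (j ℓ))))) ∧
     ((∃ y : V, (∀ ℓ : Fin k, (ℓ : ℕ) < m → ¬ G.Adj y (a (i ℓ))) ∧
                (∀ ℓ : Fin k, m ≤ (ℓ : ℕ) → G.Adj y (a (i ℓ)))) ↔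
      (∃ y : V, (∀ ℓ : Fin k, (ℓ : ℕ) < m → ¬ G.Adj y (a (j ℓ))) ∧
                (∀ ℓ : Fin k, m ≤ (ℓ : ℕ) → G.Adj y (a (j ℓ)))))))

end Paper

open Paper

namespace Paper

/-- A singleton has a sharp average: it is good, and averages are adjacencies. -/
lemma avgIs_singleton {V : Type} (G : SimpleGraph V) {ε : ℝ} (hε0 : 0 < ε) (hε1 : ε ≤ 1)
    (a b : V) (t : Bool) : AvgIs G ε {b} a t ↔ (G.Adj a b ↔ t = true) := by
  unfold AvgIs
  by_cases h : G.Adj a b ↔ t = true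
  · simp [Finset.filter_singleton, h, hε0]
  · simp [Finset.filter_singleton, h, hε1]

lemma good_singleton {V : Type} (G : SimpleGraph V) {ε : ℝ} (hε0 : 0 < ε) (hε1 : ε ≤ 1)
    (b : V) : Good G ε {b} := fun a =>
  ⟨decide (G.Adj a b), (avgIs_singleton G hε0 hε1 a b _).2 (by simp)⟩

/-- A set that is not excellent is split by a good set into two large pieces. -/
lemma exists_good_splitting {V : Type} (G : SimpleGraph V) {ε : ℝ} (hε0 : 0 < ε) (hε1 : ε ≤ 1)
    {A : Finset V} (hA : ¬ Excellent G ε ε A) :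
    ∃ B : Finset V, Good G ε B ∧
      ∀ t : Bool, ε * A.card ≤ ((A.filter fun a => ¬ AvgIs G ε B a t).card : ℝ) := by
  by_cases hgood : Good G ε A
  · simpa [Excellent, hgood] using hA
  · simp only [Good, AvgIs, not_forall, not_exists, not_lt] at hgood
    obtain ⟨b, hb⟩ := hgood
    refine ⟨{b}, good_singleton G hε0 hε1 b, fun t => ?_⟩
    simpa only [avgIs_singleton G hε0 hε1, G.adj_comm b] using hb t

/-- If fewer than `1 / ε` vertices have prescribed averages over a nonempty set `B`, some element
of `B` realises all of them simultaneously. -/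
lemma exists_adj_iff_of_avgIs {V ι : Type} (G : SimpleGraph V) {ε : ℝ}
    {B : Finset V} (hB : 0 < B.card) (S : Finset ι) (hS : S.card * ε < 1)
    (a : ι → V) (t : ι → Bool) (h : ∀ i ∈ S, AvgIs G ε B (a i) (t i)) :
    ∃ b ∈ B, ∀ i ∈ S, (G.Adj (a i) b ↔ t i = true) := by
  by_contra! hcon
  have hsub : B ⊆ S.biUnion fun i => B.filter fun b => ¬ (G.Adj (a i) b ↔ t i = true) := by
    intro b hb
    obtain ⟨i, hi, hib⟩ := hcon b hb
    simp only [Finset.mem_biUnion, Finset.mem_filter]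
    exact ⟨i, hi, hb, by tauto⟩
  have hcard : (B.card : ℝ) ≤ ∑ i ∈ S,
      ((B.filter fun b => ¬ (G.Adj (a i) b ↔ t i = true)).card : ℝ) := by
    exact_mod_cast (Finset.card_le_card hsub).trans Finset.card_biUnion_le
  have hsum : ∑ i ∈ S, ((B.filter fun b => ¬ (G.Adj (a i) b ↔ t i = true)).card : ℝ)
      ≤ ∑ _i ∈ S, ε * B.card := Finset.sum_le_sum fun i hi => (h i hi).le
  rw [Finset.sum_const, nsmul_eq_mul] at hsum
  have hB' : (0 : ℝ) < B.card := by exact_mod_cast hB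
  nlinarith

/-- The piece of `A` reached after `n` steps along the branch `x`, splitting with `f`. -/
def branchNode {α : Type} (f : α → Bool → α) (A : α) (x : ℕ → Bool) : ℕ → α
  | 0 => A
  | n + 1 => f (branchNode f A x n) (x n)

lemma branchNode_congr {α : Type} (f : α → Bool → α) (A : α) {x y : ℕ → Bool} {n : ℕ}
    (h : ∀ i < n, x i = y i) : branchNode f A x n = branchNode f A y n := by
  induction n with
  | zero => rfl
  | succ n ih =>
    simp only [branchNode]
    rw [ih fun i hi => h i (hi.trans n.lt_succ_self), h n n.lt_succ_self]

/-- The extension of a finite binary sequence by `false`. -/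
def extendFalse {n : ℕ} (η : Fin n → Bool) (i : ℕ) : Bool :=
  if h : i < n then η ⟨i, h⟩ else false

lemma extendFalse_of_lt {n : ℕ} (η : Fin n → Bool) {i : ℕ} (h : i < n) :
    extendFalse η i = η ⟨i, h⟩ := dif_pos h

end Paper

theorem stmt7 (kss : ℕ) (V : Type) [Fintype V] (G : SimpleGraph V)
    (hG : NoTreeProp G kss) (ε : ℝ) (hε0 : 0 < ε) (hε1 : ε < 1 / 2 ^ kss) :
    ∀ A : Finset V, 1 / ε ^ kss ≤ (A.card : ℝ) →
      ∃ A' ⊆ A, ε ^ (kss - 1) * A.card ≤ (A'.card : ℝ) ∧ Excellent G ε ε A' := by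
  intro A hA
  by_contra! hcon
  have hε_le : ε ≤ 1 := hε1.le.trans (by
    rw [div_le_one (by positivity)]
    exact one_le_pow₀ (by norm_num))
  have hsplit : ∀ A' : Finset V, A' ⊆ A → ε ^ (kss - 1) * A.card ≤ (A'.card : ℝ) →
      ∃ B : Finset V, Good G ε B ∧
        ∀ t : Bool, ε * A'.card ≤ ((A'.filter fun a => ¬ AvgIs G ε B a t).card : ℝ) :=
    fun A' hA' hc => exists_good_splitting G hε0 hε_le (hcon A' hA' hc)
  choose! B hBgood hBsplit using hsplit
  let f : Finset V → Bool → Finset V := fun A' i =>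
    A'.filter fun a => ¬ AvgIs G ε (B A') a (!i)
  have hsub : ∀ x n, branchNode f A x n ⊆ A := by
    intro x n
    induction n with
    | zero => exact Finset.Subset.refl _
    | succ n ih => exact (Finset.filter_subset _ _).trans ih
  have hanti : ∀ x, Antitone (branchNode f A x) := fun x =>
    antitone_nat_of_succ_le fun n => Finset.filter_subset _ _
  have hlarge : ∀ n < kss, ε ^ (kss - 1) ≤ ε ^ n := fun n hn =>
    pow_le_pow_of_le_one hε0.le hε_le (by omega)
  have hcard : ∀ x n, n ≤ kss → ε ^ n * A.card ≤ ((branchNode f A x n).card : ℝ) := by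
    intro x n
    induction n with
    | zero => intro _; simp [branchNode]
    | succ n ih =>
      intro hn
      have h := ih (by omega)
      have hbig := (mul_le_mul_of_nonneg_right (hlarge n hn) (Nat.cast_nonneg A.card)).trans h
      refine le_trans ?_ (hBsplit _ (hsub x n) hbig (!x n))
      rw [pow_succ', mul_assoc]
      exact mul_le_mul_of_nonneg_left h hε0.le
  have hnonempty : ∀ η : Fin kss → Bool, (branchNode f A (extendFalse η) kss).Nonempty := by
    intro η
    have h := hcard (extendFalse η) kss le_rfl
    have h1 : 1 ≤ ε ^ kss * A.card := by
      rwa [div_le_iff₀' (by positivity)] at hA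
    rw [← Finset.card_pos]
    exact_mod_cast (zero_lt_one.trans_le (h1.trans h) : (0 : ℝ) < _)
  choose a ha using hnonempty
  have hb : ∀ (m : Fin kss) (ρ : Fin (m : ℕ) → Bool), ∃ b : V, ∀ η : Fin kss → Bool,
      (∀ i : Fin (m : ℕ), η ⟨i.1, i.2.trans m.2⟩ = ρ i) → (G.Adj (a η) b ↔ η m = true) := by
    intro m ρ
    set N := branchNode f A (extendFalse ρ) m with hN
    have hgood : Good G ε (B N) := hBgood N (hsub _ _)
      ((mul_le_mul_of_nonneg_right (hlarge m m.2) (Nat.cast_nonneg A.card)).trans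
        (hcard _ m m.2.le))
    have hpos : 0 < (B N).card := by
      obtain ⟨t, ht⟩ := hgood (a fun _ => false)
      have h0 : 0 < ε * ((B N).card : ℝ) := (Nat.cast_nonneg _).trans_lt ht
      exact_mod_cast pos_of_mul_pos_right h0 hε0.le
    let S : Finset (Fin kss → Bool) := Finset.univ.filter fun η =>
      ∀ i : Fin (m : ℕ), η ⟨i.1, i.2.trans m.2⟩ = ρ i
    have hS : (S.card : ℝ) * ε < 1 := by
      have h2 : (S.card : ℝ) ≤ 2 ^ kss := by
        have := Finset.card_le_univ S
        simp only [Fintype.card_fun, Fintype.card_bool, Fintype.card_fin] at this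
        exact_mod_cast this
      rw [lt_div_iff₀ (by positivity)] at hε1
      nlinarith
    obtain ⟨b, -, hb⟩ := exists_adj_iff_of_avgIs G hpos S hS a (fun η => η m) (by
      intro η hη
      have hη' : ∀ i : Fin (m : ℕ), η ⟨i.1, i.2.trans m.2⟩ = ρ i := (Finset.mem_filter.1 hη).2
      have hnode : branchNode f A (extendFalse η) m = N := branchNode_congr f A fun i hi => by
        rw [extendFalse_of_lt η (hi.trans m.2), extendFalse_of_lt ρ hi]
        exact hη' ⟨i, hi⟩
      have hmem := hanti (extendFalse η) (Nat.succ_le_of_lt m.2) (ha η)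
      simp only [branchNode, hnode, extendFalse_of_lt η m.2, f,
        Finset.mem_filter] at hmem
      obtain ⟨t, ht⟩ := hgood (a η)
      have htm : t = η m := by
        by_contra hne
        exact hmem.2 (by rwa [← Bool.eq_not.2 hne])
      rwa [← htm])
    exact ⟨b, fun η hη => hb η (Finset.mem_filter.2 ⟨Finset.mem_univ _, hη⟩)⟩
  choose b hb using hb
  exact hG ⟨a, b, fun η m ρ h => hb m ρ η h⟩
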